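/- arXiv:2410.05709 — 6 statements merged into one kernel-verified Lean document; each statement's English description precedes it below -/
import Mathlib

section
/- Let G be a finite group and p a prime such that |G| = p^α · N with α ≥ 1 and gcd(p, N) = 1. If p does not divide the size of any conjugacy class of G, then p^α divides the index [G : G'] of the commutator subgroup (equivalently, p^α divides |G/G'|). -/
/-- A subgroup of a finite group that meets every conjugacy class is the whole group. -/
theorem Subgroup.eq_top_of_forall_exists_conj_mem {G : Type*} [Group G] [Finite G]
    (H : Subgroup G) (hH : ∀ g : G, ∃ x : G, x * g * x⁻¹ ∈ H) : H = ⊤ := by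
  classical
  have := Fintype.ofFinite G
  have burnside := MulAction.sum_card_fixedBy_eq_card_orbits_mul_card_group G (G ⧸ H)
  have h_orbits : Fintype.card (Quotient (MulAction.orbitRel G (G ⧸ H))) = 1 := by
    rw [Fintype.card_eq_one_iff_nonempty_unique]
    have := (MulAction.pretransitive_iff_subsingleton_quotient G (G ⧸ H)).1 inferInstance
    exact ⟨⟨⟨Quotient.mk _ ((1 : G) : G ⧸ H)⟩, fun _ => Subsingleton.elim _ _⟩⟩
  have h_pos (g : G) : 1 ≤ Fintype.card (MulAction.fixedBy (G ⧸ H) g) := by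
    obtain ⟨x, hx⟩ := hH g
    refine Fintype.card_pos_iff.2 ⟨⟨((x⁻¹ : G) : G ⧸ H), ?_⟩⟩
    rw [MulAction.mem_fixedBy, eq_comm, MulAction.Quotient.smul_coe, QuotientGroup.eq]
    simpa [mul_assoc] using hx
  have h_one : Fintype.card (MulAction.fixedBy (G ⧸ H) (1 : G)) = H.index := by
    rw [← Nat.card_eq_fintype_card, MulAction.fixedBy_one_eq_univ, Nat.card_univ]
    rfl
  rw [h_orbits, one_mul, ← Finset.card_univ, Finset.card_eq_sum_ones] at burnside
  have h_eq := (Finset.sum_eq_sum_iff_of_le fun g _ => h_pos g).1 burnside.symm 1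
    (Finset.mem_univ _)
  rw [← Subgroup.index_eq_one, ← h_one, ← h_eq]

/-- A `p`-subgroup centralizes some member of every conjugacy class of size prime to `p`. -/
theorem IsPGroup.exists_conj_mem_centralizer {G : Type*} [Group G] [Finite G] {p : ℕ}
    [Fact p.Prime] {P : Subgroup G} (hP : IsPGroup p P) {g : G}
    (hg : ¬ p ∣ Nat.card {h : G | IsConj g h}) :
    ∃ x : G, x * g * x⁻¹ ∈ Subgroup.centralizer (P : Set G) := by
  have h_orbit : {h : G | IsConj g h} = MulAction.orbit (ConjAct G) g := by
    ext h
    rw [ConjAct.mem_orbit_conjAct]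
    exact isConj_comm
  rw [h_orbit] at hg
  obtain ⟨⟨_, x, rfl⟩, hx⟩ := (hP.map (ConjAct.toConjAct (G := G)).toMonoidHom)
    |>.nonempty_fixed_point_of_prime_not_dvd_card (MulAction.orbit (ConjAct G) g) hg
  refine ⟨ConjAct.ofConjAct x, Subgroup.mem_centralizer_iff.2 fun y hy => ?_⟩
  have h_fix := congrArg Subtype.val (hx ⟨ConjAct.toConjAct y, Subgroup.mem_map_of_mem _ hy⟩)
  exact mul_inv_eq_iff_eq_mul.1 h_fix

/-- **Corollary 4.4.** Let `G` be a finite group and `p` a prime such that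
`|G| = p ^ α * N` with `α ≥ 1` and `gcd(p, N) = 1`. If `p` does not divide the size of
any conjugacy class of `G`, then `p ^ α` divides the index `[G : G']` of the commutator
subgroup. -/
theorem conjClass_sizes_coprime_imp_pow_dvd_index_commutator
    {G : Type*} [Group G] [Finite G] (p N α : ℕ) (hp : p.Prime) (hα : 1 ≤ α)
    (hcard : Nat.card G = p ^ α * N) (hcop : Nat.Coprime p N)
    (hconj : ∀ g : G, ¬ p ∣ Nat.card {h : G | IsConj g h}) :
    p ^ α ∣ (commutator G).index := by
  have : Fact p.Prime := ⟨hp⟩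
  obtain ⟨P⟩ : Nonempty (Sylow p G) := inferInstance
  have h_top : Subgroup.centralizer (P : Set G) = ⊤ :=
    Subgroup.eq_top_of_forall_exists_conj_mem _ fun g =>
      P.isPGroup'.exists_conj_mem_centralizer (hconj g)
  have hP : Subgroup.normalizer (P : Set G) ≤ Subgroup.centralizer (P : Set G) :=
    h_top ▸ le_top
  have h_comm : commutator G ≤ (MonoidHom.transferSylow P hP).ker := by
    rw [commutator_def, Subgroup.commutator_le]
    intro x _ y _
    have h_mul (a b : P) : a * b = b * a := by
      have hb : (b : G) ∈ Subgroup.centralizer (P : Set G) := h_top ▸ Subgroup.mem_top _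
      exact Subtype.ext (Subgroup.mem_centralizer_iff.1 hb a a.2)
    rw [MonoidHom.mem_ker, map_commutatorElement, commutatorElement_eq_one_iff_mul_comm]
    exact h_mul _ _
  refine dvd_trans ?_ (Subgroup.index_dvd_of_le h_comm)
  rw [(MonoidHom.ker_transferSylow_isComplement' P hP).symm.index_eq_card]
  exact P.pow_dvd_card_of_pow_dvd_card (hcard ▸ dvd_mul_right _ _)
end

section
/- If G is a finite nilpotent group, then the size of every conjugacy class of G divides |G'|, the order of the commutator subgroup of G. -/
open scoped commutatorElement in
/-- In a finite nilpotent group, the index of every element centralizer divides the order of the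
commutator subgroup. -/
theorem index_centralizer_dvd_card_commutator {G : Type*} [Group G] [Finite G]
    [Group.IsNilpotent G] (g : G) :
    (Subgroup.centralizer {g}).index ∣ Nat.card (commutator G) := by
  revert g
  refine Group.nilpotent_center_quotient_ind
    (P := fun H _ _ => Finite H → ∀ g : H,
      (Subgroup.centralizer {g}).index ∣ Nat.card (commutator H)) G ?_ ?_ ‹Finite G›
  · intro H _ _ _ g
    simp [Subsingleton.elim g 1]
  · intro H _ _ ih _ g
    let q := QuotientGroup.mk' (Subgroup.center H)
    let C : Subgroup H := Subgroup.centralizer {g}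
    let D : Subgroup H := (Subgroup.centralizer {q g}).comap q
    have hq : Function.Surjective q := QuotientGroup.mk'_surjective _
    have hker : q.ker = Subgroup.center H := QuotientGroup.ker_mk' _
    have hCD : C ≤ D := by
      intro x hx
      rw [Subgroup.mem_comap, Subgroup.mem_centralizer_singleton_iff, ← map_mul, ← map_mul,
        Subgroup.mem_centralizer_singleton_iff.mp hx]
    have hDZ (x : D) : ⁅(x : H), g⁆ ∈ Subgroup.center H := by
      rw [← hker, MonoidHom.mem_ker, map_commutatorElement, commutatorElement_eq_one_iff_mul_comm]
      exact Subgroup.mem_centralizer_singleton_iff.mp x.2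
    let f : D →* H := MonoidHom.mk' (fun x => ⁅(x : H), g⁆) fun x y => by
      have hy := Subgroup.mem_center_iff.mp (hDZ y) x
      calc ⁅(x * y : H), g⁆ = x * ⁅(y : H), g⁆ * (g * (x : H)⁻¹ * g⁻¹) := by
            simp only [commutatorElement_def]; group
        _ = ⁅(y : H), g⁆ * ⁅(x : H), g⁆ := by
            rw [hy]; simp only [commutatorElement_def]; group
        _ = ⁅(x : H), g⁆ * ⁅(y : H), g⁆ := (Subgroup.mem_center_iff.mp (hDZ y) _).symm
    have hfker : f.ker = C.subgroupOf D := by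
      ext x
      rw [MonoidHom.mem_ker, Subgroup.mem_subgroupOf, Subgroup.mem_centralizer_singleton_iff]
      exact commutatorElement_eq_one_iff_mul_comm
    have hrange : f.range ≤ Subgroup.center H ⊓ commutator H := by
      rintro _ ⟨x, rfl⟩
      exact ⟨hDZ x, Subgroup.commutator_mem_commutator (Subgroup.mem_top _) (Subgroup.mem_top _)⟩
    have hmap : (commutator H).map q = commutator (H ⧸ Subgroup.center H) := by
      rw [commutator_def, Subgroup.map_commutator, Subgroup.map_top_of_surjective q hq,
        commutator_def]
    have hcard : Nat.card (commutator H) =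
        Nat.card ↥(Subgroup.center H ⊓ commutator H) *
          Nat.card (commutator (H ⧸ Subgroup.center H)) := by
      rw [← hmap, ← Subgroup.relIndex_ker, hker, ← Subgroup.relIndex_bot_left,
        ← Subgroup.relIndex_bot_left, ← Subgroup.inf_relIndex_right (Subgroup.center H)]
      exact (Subgroup.relIndex_mul_relIndex _ _ _ bot_le inf_le_right).symm
    have hCDcard : C.relIndex D = Nat.card f.range := by
      rw [Subgroup.relIndex, ← hfker, Subgroup.index_ker]
    have hD : D.index = (Subgroup.centralizer {q g}).index :=
      Subgroup.index_comap_of_surjective _ hq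
    rw [← Subgroup.relIndex_mul_index hCD, hCDcard, hD, hcard]
    exact mul_dvd_mul (Subgroup.card_dvd_of_le hrange) (ih inferInstance (q g))

/-- If `G` is a finite nilpotent group, then the size of every conjugacy class of `G`
divides `|G'|`, the order of the commutator subgroup of `G`. -/
theorem card_conjClass_dvd_card_commutator_of_nilpotent
    {G : Type*} [Group G] [Finite G] [Group.IsNilpotent G] (g : G) :
    Nat.card {h : G | IsConj g h} ∣ Nat.card (commutator G) := by
  have hclass : {h : G | IsConj g h} = MulAction.orbit (ConjAct G) g := by
    ext h
    rw [ConjAct.mem_orbit_conjAct, isConj_comm, Set.mem_ofPred_eq]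
  have hcard : Nat.card {h : G | IsConj g h} = (Subgroup.centralizer {g}).index := by
    rw [hclass, Nat.card_coe_set_eq, ← MulAction.index_stabilizer,
      ConjAct.stabilizer_eq_centralizer]
    rfl
  rw [hcard]
  exact index_centralizer_dvd_card_commutator g
end

section
/- If G is a finite nilpotent group, then a prime p divides |G'| if and only if p divides the size of at least one conjugacy class of G. -/
open Subgroup

theorem natCard_setOf_isConj_eq_index_centralizer {G : Type*} [Group G] (g : G) :
    Nat.card {h : G | IsConj g h} = (centralizer {g}).index := by
  have h := MulAction.index_stabilizer (ConjAct G) g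
  rw [ConjAct.stabilizer_eq_centralizer, ConjAct.orbit_eq_carrier_conjClasses] at h
  have hset : (ConjClasses.mk g).carrier = {h : G | IsConj g h} := by
    ext x
    rw [ConjClasses.mem_carrier_iff_mk_eq, ConjClasses.mk_eq_mk_iff_isConj, isConj_comm]
    rfl
  rw [hset] at h
  rw [Nat.card_coe_set_eq]
  exact h.symm

/-- A normal Sylow `p`-subgroup is central if and only if `p` does not divide the order of the
commutator subgroup. -/
theorem Sylow.le_center_iff_not_dvd_card_commutator {G : Type*} [Group G] [Finite G] {p : ℕ}
    [Fact p.Prime] (P : Sylow p G) [(P : Subgroup G).Normal] :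
    (P : Subgroup G) ≤ center G ↔ ¬ p ∣ Nat.card (commutator G) := by
  constructor
  · intro hP
    have hN : normalizer (P : Set G) ≤ centralizer (P : Set G) :=
      fun g _ x hx => (mem_center_iff.mp (hP hx) g).symm
    have hker : commutator G ≤ (MonoidHom.transferSylow P hN).ker := by
      refine commutator_le.mpr fun a _ b _ => ?_
      rw [MonoidHom.mem_ker, map_commutatorElement, commutatorElement_eq_one_iff_mul_comm]
      exact Subtype.ext (mem_center_iff.mp (hP (Subtype.prop _)) _)
    exact fun h => MonoidHom.not_dvd_card_ker_transferSylow P hN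
      (h.trans (card_dvd_of_le hker))
  · intro h
    have hdisj : Disjoint (P : Subgroup G) (commutator G) := by
      apply disjoint_of_coprime_natCard
      obtain ⟨n, hn⟩ := P.isPGroup'.exists_card_eq
      rw [hn]
      exact Nat.Coprime.pow_left n ((Nat.Prime.coprime_iff_not_dvd Fact.out).mpr h)
    rw [← centralizer_univ, ← coe_top, ← commutator_eq_bot_iff_le_centralizer, ← le_bot_iff]
    exact hdisj (commutator_le_left _ _) (commutator_mono le_top le_rfl)

/-- A normal Sylow `p`-subgroup is central if and only if `p` divides no conjugacy class size. -/
theorem Sylow.le_center_iff_forall_not_dvd_card_isConj {G : Type*} [Group G] [Finite G] {p : ℕ}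
    [Fact p.Prime] (P : Sylow p G) [(P : Subgroup G).Normal] :
    (P : Subgroup G) ≤ center G ↔ ∀ g : G, ¬ p ∣ Nat.card {h : G | IsConj g h} := by
  simp_rw [natCard_setOf_isConj_eq_index_centralizer]
  constructor
  · exact fun hP g h => P.not_dvd_index
      (h.trans (index_dvd_of_le (hP.trans (center_le_centralizer _))))
  · intro h x hx
    refine mem_center_iff.mpr fun g => ?_
    set C : Subgroup G := centralizer {g}
    have hmul : C.relIndex P * (P : Subgroup G).index = (P : Subgroup G).relIndex C * C.index := by
      rw [← inf_relIndex_right C, relIndex_mul_index inf_le_right, ← inf_relIndex_left C,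
        inf_comm, relIndex_mul_index inf_le_right, inf_comm]
    obtain ⟨n, hn⟩ := P.isPGroup'.index (C.subgroupOf P)
    have hcop : (C.relIndex P).Coprime ((P : Subgroup G).relIndex C * C.index) := by
      have hp : p.Prime := Fact.out
      rw [relIndex, hn]
      refine Nat.Coprime.pow_left n (hp.coprime_iff_not_dvd.mpr fun hdvd => ?_)
      exact (hp.dvd_mul.mp hdvd).elim
        (fun hd => P.not_dvd_index (hd.trans (relIndex_dvd_index_of_normal _ _))) (h g)
    have hone : C.relIndex P = 1 := Nat.eq_one_of_dvd_coprimes hcop dvd_rfl (Dvd.intro _ hmul)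
    exact mem_centralizer_iff.mp (relIndex_eq_one.mp hone hx) g rfl

/-- If `G` is a finite nilpotent group, then a prime `p` divides `|G'|` if and only if
`p` divides the size of at least one conjugacy class of `G`. -/
theorem prime_dvd_card_commutator_iff_dvd_card_conjClass_of_nilpotent
    {G : Type*} [Group G] [Finite G] [Group.IsNilpotent G] (p : ℕ) (hp : p.Prime) :
    p ∣ Nat.card (commutator G) ↔ ∃ g : G, p ∣ Nat.card {h : G | IsConj g h} := by
  have : Fact p.Prime := ⟨hp⟩
  let P : Sylow p G := default
  have h := P.le_center_iff_not_dvd_card_commutator.symm.trans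
    P.le_center_iff_forall_not_dvd_card_isConj
  simpa using not_congr h
end

section
/- Let G be a finite group, let K_0, …, K_m be its conjugacy classes, and let P = ∏_{j=0}^{m} |K_j| be the product of all conjugacy class sizes. Then |G'| divides P². -/
open Module

/-- The eigenvalues of an endomorphism of finite order, with multiplicity, compute the traces of
all of its powers. -/
theorem LinearMap.exists_multiset_trace_pow {K V : Type*} [Field K] [IsAlgClosed K] [CharZero K]
    [AddCommGroup V] [Module K V] [FiniteDimensional K V] {f : End K V} {n : ℕ} (hn : n ≠ 0)
    (hf : f ^ n = 1) :
    ∃ s : Multiset K, (∀ μ ∈ s, μ ^ n = 1) ∧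
      ∀ j : ℕ, LinearMap.trace K V (f ^ j) = (s.map (· ^ j)).sum := by
  classical
  have hss : f.IsSemisimple := by
    refine End.isSemisimple_of_squarefree_aeval_eq_zero (p := Polynomial.X ^ n - 1) ?_ ?_
    · exact (Polynomial.X_pow_sub_one_separable_iff.2 (Nat.cast_ne_zero.2 hn)).squarefree
    · simp [hf]
  have hint : DirectSum.IsInternal fun μ : K ↦ f.eigenspace μ :=
    (DirectSum.isInternal_submodule_iff_iSupIndep_and_iSup_eq_top _).2
      ⟨f.eigenspaces_iSupIndep, hss.iSup_eigenspace_eq_top⟩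
  have hfin : {μ | f.eigenspace μ ≠ ⊥}.Finite :=
    WellFoundedGT.finite_ne_bot_of_iSupIndep f.eigenspaces_iSupIndep
  have happ (μ : K) (v : V) (hv : v ∈ f.eigenspace μ) (j : ℕ) : (f ^ j) v = μ ^ j • v := by
    induction j with
    | zero => simp
    | succ j ih => rw [pow_succ', Module.End.mul_apply, ih, map_smul,
        End.mem_eigenspace_iff.1 hv, smul_smul, pow_succ]
  refine ⟨∑ μ ∈ hfin.toFinset, Multiset.replicate (finrank K (f.eigenspace μ)) μ, ?_, ?_⟩
  · intro μ hμ
    obtain ⟨ν, hν, hμν⟩ := Multiset.mem_sum.1 hμ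
    obtain rfl := Multiset.eq_of_mem_replicate hμν
    obtain ⟨v, hv, hv0⟩ := (Submodule.ne_bot_iff _).1 (hfin.mem_toFinset.1 hν)
    have h := happ μ v hv n
    rw [hf, Module.End.one_apply] at h
    exact smul_left_injective K hv0 (by simpa using h.symm)
  · intro j
    have hmaps (μ : K) : Set.MapsTo (f ^ j) (f.eigenspace μ) (f.eigenspace μ) := fun v hv ↦ by
      rw [happ μ v hv j]
      exact Submodule.smul_mem _ _ hv
    rw [LinearMap.trace_eq_sum_trace_restrict' hint hfin hmaps, ← Multiset.coe_mapAddMonoidHom,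
      map_sum, ← Multiset.coe_sumAddMonoidHom, map_sum]
    refine Finset.sum_congr rfl fun μ _ ↦ ?_
    have : (f ^ j).restrict (hmaps μ) = μ ^ j • LinearMap.id := by
      ext v
      exact happ μ v v.2 j
    rw [this]
    simp [mul_comm]

namespace Representation

section

variable {K G V : Type*} [Field K] [IsAlgClosed K] [CharZero K] [Group G] [Finite G]
  [AddCommGroup V] [Module K V] [FiniteDimensional K V] (ρ : Representation K G V)

theorem exists_multiset_character_pow (g : G) :
    ∃ s : Multiset K, (∀ μ ∈ s, μ ^ Nat.card G = 1) ∧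
      ∀ j : ℕ, ρ.character (g ^ j) = (s.map (· ^ j)).sum := by
  simpa [character] using LinearMap.exists_multiset_trace_pow (f := ρ g) Nat.card_pos.ne'
    (by rw [← map_pow, pow_card_eq_one', map_one])

theorem isIntegral_character (g : G) : IsIntegral ℤ (ρ.character g) := by
  obtain ⟨s, hs, h⟩ := ρ.exists_multiset_character_pow g
  rw [← pow_one g, h 1]
  refine IsIntegral.multiset_sum fun x hx ↦ ?_
  obtain ⟨μ, hμ, rfl⟩ := Multiset.mem_map.1 hx
  refine IsIntegral.pow (IsIntegral.of_pow Nat.card_pos (n := Nat.card G) ?_) 1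
  rw [hs μ hμ]
  exact isIntegral_one

theorem map_character_inv (φ : K →+* ℂ) (g : G) :
    φ (ρ.character g⁻¹) = starRingEnd ℂ (φ (ρ.character g)) := by
  obtain ⟨s, hs, h⟩ := ρ.exists_multiset_character_pow g
  have hinv : g⁻¹ = g ^ (Nat.card G - 1) := by
    rw [inv_eq_iff_mul_eq_one, ← pow_succ', Nat.sub_add_cancel Nat.card_pos, pow_card_eq_one']
  have h1 := h 1
  rw [pow_one] at h1
  rw [hinv, h, h1, map_multiset_sum, map_multiset_sum, map_multiset_sum, Multiset.map_map,
    Multiset.map_map, Multiset.map_map]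
  congr 1
  refine Multiset.map_congr rfl fun μ hμ ↦ ?_
  have hμ1 : φ μ ^ Nat.card G = 1 := by rw [← map_pow, hs μ hμ, map_one]
  have hmul : φ μ * φ μ ^ (Nat.card G - 1) = 1 := by
    rw [← pow_succ', Nat.sub_add_cancel Nat.card_pos, hμ1]
  simp only [Function.comp_apply, map_pow, pow_one]
  rw [← Complex.inv_eq_conj (Complex.norm_eq_one_of_pow_eq_one hμ1 Nat.card_pos.ne')]
  exact eq_inv_of_mul_eq_one_right hmul

theorem exists_coprime_map_character (σ : K ≃+* K) :
    ∃ i : ℕ, (Nat.card G).Coprime i ∧ ∀ g, σ (ρ.character g) = ρ.character (g ^ i) := by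
  have : NeZero (Nat.card G) := ⟨Nat.card_pos.ne'⟩
  have : NeZero (Nat.card G : K) := ⟨Nat.cast_ne_zero.2 Nat.card_pos.ne'⟩
  obtain ⟨ζ, hζ⟩ := HasEnoughRootsOfUnity.exists_primitiveRoot K (Nat.card G)
  obtain ⟨i, -, hi, hσ⟩ := hζ.isPrimitiveRoot_iff.1 (hζ.map_of_injective σ.injective)
  refine ⟨i, hi.symm, fun g ↦ ?_⟩
  obtain ⟨s, hs, h⟩ := ρ.exists_multiset_character_pow g
  have h1 := h 1
  rw [pow_one] at h1
  rw [h, h1, map_multiset_sum, Multiset.map_map]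
  congr 1
  refine Multiset.map_congr rfl fun μ hμ ↦ ?_
  obtain ⟨j, -, rfl⟩ := hζ.eq_pow_of_pow_eq_one (hs μ hμ)
  simp only [Function.comp_apply, pow_one, map_pow, ← hσ]
  rw [← pow_mul, ← pow_mul, mul_comm]

end

section

variable {K G V : Type*} [Field K] [IsAlgClosed K] [CharZero K] [Algebra.IsAlgebraic ℚ K]
  [Group G] [Fintype G] [AddCommGroup V] [Module K V] [FiniteDimensional K V]
  (ρ : Representation K G V)

theorem exists_int_prod_character : ∃ m : ℤ, ∏ g, ρ.character g = m := by
  have : IsAlgClosure ℚ K := ⟨inferInstance, inferInstance⟩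
  have : Normal ℚ K := IsAlgClosure.normal ℚ K
  have : IsGalois ℚ K := ⟨⟩
  have hfix : ∏ g, ρ.character g ∈ Set.range (algebraMap ℚ K) := by
    rw [InfiniteGalois.mem_range_algebraMap_iff_fixed]
    intro σ
    obtain ⟨i, hi, h⟩ := ρ.exists_coprime_map_character σ.toRingEquiv
    rw [map_prod]
    exact Fintype.prod_equiv (powCoprime hi) _ _ h
  obtain ⟨q, hq⟩ := hfix
  have hint : IsIntegral ℤ (algebraMap ℚ K q) := by
    rw [hq]
    exact IsIntegral.prod _ fun g _ ↦ ρ.isIntegral_character g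
  obtain ⟨m, rfl⟩ := IsIntegrallyClosed.isIntegral_iff.1
    ((isIntegral_algebraMap_iff (algebraMap ℚ K).injective).1 hint)
  exact ⟨m, by simp [← hq]⟩

/-- Burnside: an irreducible character without zeros is linear. -/
theorem finrank_eq_one_of_character_ne_zero [IsIrreducible ρ] (h : ∀ g, ρ.character g ≠ 0) :
    finrank K V = 1 := by
  let φ : K →+* ℂ := (IsAlgClosed.lift : K →ₐ[ℚ] ℂ).toRingHom
  let a : G → ℝ := fun g ↦ Complex.normSq (φ (ρ.character g))
  have hpos (g : G) : 0 < a g :=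
    Complex.normSq_pos.2 ((map_ne_zero φ).2 (h g))
  have hsum : ∑ g, a g = Fintype.card G := by
    have hc : (Nat.card G : K) ≠ 0 := Nat.cast_ne_zero.2 Nat.card_pos.ne'
    let : Invertible (Nat.card G : K) := invertibleOfNonzero hc
    have ho := char_orthonormal ρ ρ
    rw [if_pos ⟨Equiv.refl ρ⟩, inv_mul_eq_iff_eq_mul₀ hc, mul_one] at ho
    have := congrArg φ ho
    simp only [map_sum, map_mul, map_character_inv, Complex.mul_conj, map_natCast] at this
    rw [Nat.card_eq_fintype_card] at this
    exact_mod_cast this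
  have hprod : 1 ≤ ∏ g, a g := by
    obtain ⟨m, hm⟩ := ρ.exists_int_prod_character
    have hm0 : m ≠ 0 := by
      rintro rfl
      exact Finset.prod_ne_zero_iff.2 (fun g _ ↦ h g) (by simpa using hm)
    have : ∏ g, a g = (m : ℝ) ^ 2 := by
      simp only [a]
      rw [← map_prod, ← map_prod, hm, map_intCast, Complex.normSq_intCast, sq]
    rw [this]
    exact_mod_cast (by positivity : 0 < m ^ 2)
  have hlog : 0 ≤ ∑ g, Real.log (a g) := by
    rw [← Real.log_prod fun g _ ↦ (hpos g).ne']
    exact Real.log_nonneg hprod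
  have h1 : a 1 = 1 := by
    by_contra hne
    have hlt : ∑ g, Real.log (a g) < ∑ g, (a g - 1) :=
      Finset.sum_lt_sum (fun g _ ↦ Real.log_le_sub_one_of_pos (hpos g))
        ⟨1, Finset.mem_univ _, Real.log_lt_sub_one_of_pos (hpos 1) hne⟩
    rw [Finset.sum_sub_distrib, hsum] at hlt
    simp at hlt
    exact absurd hlog hlt.not_ge
  simp only [a, char_one, map_natCast, Complex.normSq_natCast] at h1
  have : finrank K V * finrank K V = 1 := by
    exact_mod_cast h1
  exact Nat.eq_one_of_mul_eq_one_right this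

end

end Representation

open scoped Classical in
/-- The sum of the elements of a conjugacy class, as an element of the group algebra. -/
noncomputable def ConjClasses.sum (R : Type*) {G : Type*} [Semiring R] [Group G] [Fintype G]
    (c : ConjClasses G) : MonoidAlgebra R G :=
  ∑ g with ConjClasses.mk g = c, MonoidAlgebra.of R G g

namespace Representation

theorem apply_eq_one_of_mem_commutator {K G V : Type*} [Field K] [Group G] [AddCommGroup V]
    [Module K V] (ρ : Representation K G V) (hV : finrank K V = 1) {x : G}
    (hx : x ∈ commutator G) :
    ρ x = 1 := by
  suffices commutator G ≤ ρ.toHomUnits.ker by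
    simpa [Units.ext_iff] using this hx
  rw [commutator_eq_closure, Subgroup.closure_le]
  rintro _ ⟨g, h, rfl⟩
  have hc : ρ g * ρ h = ρ h * ρ g := by
    obtain ⟨a, ha, -⟩ := LinearMap.existsUnique_eq_smul_id_of_finrank_eq_one hV (ρ g)
    rw [ha]
    ext v
    simp
  rw [SetLike.mem_coe, MonoidHom.mem_ker, map_commutatorElement,
    commutatorElement_eq_one_iff_mul_comm]
  exact Units.ext hc

variable {K G V : Type*} [Field K] [IsAlgClosed K] [CharZero K]
  [Group G] [Fintype G] [AddCommGroup V] [Module K V] [FiniteDimensional K V]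
  (ρ : Representation K G V)

theorem asAlgebraHom_sum_eq_zero [IsIrreducible ρ] {g : G} (hg : ρ.character g = 0) :
    ρ.asAlgebraHom ((ConjClasses.mk g).sum K) = 0 := by
  classical
  set A := ρ.asAlgebraHom ((ConjClasses.mk g).sum K) with hA
  have hA' : A = ∑ x with ConjClasses.mk x = ConjClasses.mk g, ρ x := by
    simp [hA, ConjClasses.sum]
  have hcomm (h : G) : A ∘ₗ ρ h = ρ h ∘ₗ A := by
    change A * ρ h = ρ h * A
    rw [hA', Finset.sum_mul, Finset.mul_sum]
    refine Finset.sum_equiv (MulAut.conj h⁻¹).toEquiv (fun x ↦ ?_) fun x _ ↦ ?_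
    · have : ConjClasses.mk (h⁻¹ * x * h) = ConjClasses.mk x :=
        ConjClasses.mk_eq_mk_iff_isConj.2 (isConj_iff.2 ⟨h, by group⟩)
      simp [this]
    · simp [← map_mul, mul_assoc]
  obtain ⟨a, ha⟩ := (IsIrreducible.algebraMap_intertwiningMap_bijective_of_isAlgClosed
    (ρ := ρ)).2 ⟨A, hcomm⟩
  have haA : A = a • LinearMap.id := by
    ext v
    exact (DFunLike.congr_fun ha v).symm
  have htr : LinearMap.trace K V A = 0 := by
    rw [hA', map_sum]
    refine Finset.sum_eq_zero fun x hx ↦ ?_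
    obtain ⟨c, rfl⟩ := isConj_iff.1
      (ConjClasses.mk_eq_mk_iff_isConj.1 (Finset.mem_filter.1 hx).2).symm
    exact (ρ.char_conj g c).trans hg
  have : Nontrivial V := IsSimpleModule.nontrivial (MonoidAlgebra K G) ρ.asModule
  rw [haA, map_smul, LinearMap.trace_id, smul_eq_mul, mul_eq_zero] at htr
  rw [haA, htr.resolve_right (Nat.cast_ne_zero.2 finrank_pos.ne'), zero_smul]

end Representation

theorem Subgroup.card_dvd_sum {G : Type*} [Group G] [Fintype G] (H : Subgroup G) {f : G → ℕ}
    (hf : ∀ h ∈ H, ∀ g, f (h * g) = f g) :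
    Nat.card H ∣ ∑ g, f g := by
  classical
  obtain ⟨T, hT, -⟩ := H.exists_isComplement_right 1
  have := Fintype.ofFinite T
  rw [← hT.equiv.symm.sum_comp, Fintype.sum_prod_type_right, Nat.card_eq_fintype_card]
  refine Finset.dvd_sum fun t _ ↦ ?_
  have (x : H) : f (hT.equiv.symm (x, t)) = f t := hf x x.2 t
  simp [this]

section

variable {G : Type*} [Group G] [Fintype G] [Fintype (ConjClasses G)]

/-- The product, in some order, of all class sums. -/
noncomputable def ConjClasses.prodSum (R G : Type*) [Semiring R] [Group G] [Fintype G]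
    [Fintype (ConjClasses G)] : MonoidAlgebra R G :=
  ((Finset.univ : Finset (ConjClasses G)).toList.map (ConjClasses.sum R)).prod

theorem Representation.asAlgebraHom_of_mul_prodSum {K V : Type*} [Field K] [IsAlgClosed K]
    [CharZero K] [Algebra.IsAlgebraic ℚ K] [AddCommGroup V] [Module K V] [FiniteDimensional K V]
    (ρ : Representation K G V) [IsIrreducible ρ] {x : G} (hx : x ∈ commutator G) :
    ρ.asAlgebraHom (MonoidAlgebra.of K G x * ConjClasses.prodSum K G) =
      ρ.asAlgebraHom (ConjClasses.prodSum K G) := by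
  rw [map_mul]
  by_cases h : ∀ g, ρ.character g ≠ 0
  · rw [asAlgebraHom_of, ρ.apply_eq_one_of_mem_commutator
      (ρ.finrank_eq_one_of_character_ne_zero h) hx, one_mul]
  · push Not at h
    obtain ⟨g, hg⟩ := h
    have : ρ.asAlgebraHom (ConjClasses.prodSum K G) = 0 := by
      rw [ConjClasses.prodSum, map_list_prod, List.map_map]
      exact List.prod_eq_zero (List.mem_map.2 ⟨ConjClasses.mk g, by simp,
        ρ.asAlgebraHom_sum_eq_zero hg⟩)
    rw [this, mul_zero]

theorem MonoidAlgebra.smul_eq_smul_of_forall_asAlgebraHom_eq.{u, v, w} {K : Type u} {G : Type v}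
    [Group G] [Finite G] [Field K] {a b : MonoidAlgebra K G}
    (h : ∀ (V : Type w) [AddCommGroup V] [Module K V] [FiniteDimensional K V]
      (ρ : Representation K G V) [Representation.IsIrreducible ρ],
      ρ.asAlgebraHom a = ρ.asAlgebraHom b)
    {M : Type w} [AddCommGroup M] [Module (MonoidAlgebra K G) M]
    [IsSimpleModule (MonoidAlgebra K G) M] (x : M) :
    a • x = b • x := by
  let : Module K M := Module.compHom M (algebraMap K (MonoidAlgebra K G))
  have : IsScalarTower K (MonoidAlgebra K G) M := IsScalarTower.of_compHom K (MonoidAlgebra K G) M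
  have : FiniteDimensional K M := Module.Finite.trans (MonoidAlgebra K G) M
  let ρ : Representation K G M := Representation.ofModule' M
  have hρ (r : MonoidAlgebra K G) (m : M) : ρ.asAlgebraHom r m = r • m := by
    simp [ρ, Representation.ofModule', Representation.asAlgebraHom]
  let e : ρ.asModule ≃ₗ[MonoidAlgebra K G] M :=
    { ρ.asModuleEquiv with map_smul' := fun r m ↦ by simp [hρ] }
  have : Representation.IsIrreducible ρ :=
    (Representation.irreducible_iff_isSimpleModule_asModule ρ).2 (IsSimpleModule.congr e)
  rw [← hρ, ← hρ, h]

/-- An element of a semisimple group algebra is determined by its action on irreducible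
representations. -/
theorem MonoidAlgebra.eq_of_forall_asAlgebraHom_eq.{u, v} {K : Type u} {G : Type v} [Group G]
    [Finite G] [Field K] [CharZero K] {a b : MonoidAlgebra K G}
    (h : ∀ (V : Type (max u v)) [AddCommGroup V] [Module K V] [FiniteDimensional K V]
      (ρ : Representation K G V) [Representation.IsIrreducible ρ],
      ρ.asAlgebraHom a = ρ.asAlgebraHom b) :
    a = b := by
  have : NeZero (Nat.card G : K) := ⟨Nat.cast_ne_zero.2 Nat.card_pos.ne'⟩
  rw [← sub_eq_zero, ← Submodule.mem_bot (MonoidAlgebra K G),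
    ← IsSemisimpleModule.jacobson_eq_bot (MonoidAlgebra K G) (MonoidAlgebra K G),
    Module.jacobson, Submodule.mem_sInf]
  intro m hm
  have : IsSimpleModule (MonoidAlgebra K G) (MonoidAlgebra K G ⧸ m) :=
    isSimpleModule_iff_isCoatom.2 hm
  have hmk := MonoidAlgebra.smul_eq_smul_of_forall_asAlgebraHom_eq h
    (Submodule.Quotient.mk 1 : MonoidAlgebra K G ⧸ m)
  rw [← Submodule.Quotient.mk_smul, ← Submodule.Quotient.mk_smul, Submodule.Quotient.eq] at hmk
  simpa using hmk

theorem ConjClasses.map_prodSum {R S : Type*} [Semiring R] [Semiring S] (f : R →+* S) :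
    MonoidAlgebra.mapRingHom G f (ConjClasses.prodSum R G) = ConjClasses.prodSum S G := by
  rw [prodSum, prodSum, map_list_prod, List.map_map]
  congr 2
  ext c : 1
  simp [ConjClasses.sum]

theorem ConjClasses.of_mul_prodSum {x : G} (hx : x ∈ commutator G) :
    MonoidAlgebra.of ℕ G x * ConjClasses.prodSum ℕ G = ConjClasses.prodSum ℕ G := by
  have : Algebra.IsAlgebraic ℚ (AlgebraicClosure ℚ) := by
    rw [Subsingleton.elim (DivisionRing.toRatAlgebra (R := AlgebraicClosure ℚ))
      (AlgebraicClosure.instAlgebra ℚ)]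
    exact AlgebraicClosure.isAlgebraic ℚ
  have h : MonoidAlgebra.of (AlgebraicClosure ℚ) G x * ConjClasses.prodSum _ G =
      ConjClasses.prodSum _ G :=
    MonoidAlgebra.eq_of_forall_asAlgebraHom_eq fun _ _ _ _ ρ _ ↦
      ρ.asAlgebraHom_of_mul_prodSum hx
  have hinj : Function.Injective
      (MonoidAlgebra.mapRingHom G (Nat.castRingHom (AlgebraicClosure ℚ))) :=
    MonoidAlgebra.map_injective (Nat.castRingHom _).toAddMonoidHom Nat.cast_injective
  apply hinj
  rw [map_mul, map_prodSum]
  simpa using h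

theorem ConjClasses.sum_prodSum_apply :
    ∑ g, (ConjClasses.prodSum ℕ G).coeff g = ∏ c : ConjClasses G, Nat.card c.carrier := by
  classical
  let ε : MonoidAlgebra ℕ G →+* ℕ := (MonoidAlgebra.lift ℕ ℕ G 1).toRingHom
  have hε (a : MonoidAlgebra ℕ G) : ε a = ∑ g, a.coeff g := by
    change MonoidAlgebra.lift ℕ ℕ G 1 a = _
    rw [MonoidAlgebra.lift_apply, Finsupp.sum_fintype _ _ (by simp)]
    simp
  rw [← hε, prodSum, map_list_prod, List.map_map, Finset.prod_map_toList]
  refine Finset.prod_congr rfl fun c _ ↦ ?_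
  have hc : ε (c.sum ℕ) = Fintype.card {g : G // ConjClasses.mk g = c} := by
    simp [ConjClasses.sum, ε, Fintype.card_subtype]
  rw [Function.comp_apply, hc, ← Nat.card_eq_fintype_card]
  exact Nat.card_congr (Equiv.subtypeEquivRight fun g ↦ ConjClasses.mem_carrier_iff_mk_eq.symm)

/-- The order of the commutator subgroup divides the product of the class sizes. -/
theorem card_commutator_dvd_prod_card_conjClasses :
    Nat.card (commutator G) ∣ ∏ c : ConjClasses G, Nat.card c.carrier := by
  rw [← ConjClasses.sum_prodSum_apply]
  refine (commutator G).card_dvd_sum fun x hx g ↦ ?_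
  conv_lhs => rw [← ConjClasses.of_mul_prodSum hx]
  simp

end

/-- Let `G` be a finite group and `P` the product of the sizes of all of its conjugacy
classes. Then `|G'|` divides `P ^ 2`. -/
theorem card_commutator_dvd_prod_card_conjClasses_sq
    {G : Type*} [Group G] [Finite G] :
    Nat.card (commutator G) ∣ (∏ᶠ c : ConjClasses G, Nat.card c.carrier) ^ 2 := by
  have := Fintype.ofFinite G
  have := Fintype.ofFinite (ConjClasses G)
  rw [finprod_eq_prod_of_fintype]
  exact Dvd.dvd.pow card_commutator_dvd_prod_card_conjClasses two_ne_zero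
end

section
/- Let G be a finite group whose center Z(G) has odd order, let K_0, …, K_m be its conjugacy classes, and let P = ∏_{j=0}^{m} |K_j| be the product of all conjugacy class sizes. Then |G'| divides P. -/
open Polynomial

/-- The traces of the powers of an endomorphism of finite order `n` are the values, at the powers
of a primitive `n`-th root of unity, of a single polynomial with integer coefficients. -/
theorem exists_int_polynomial_trace_pow_eq {K V : Type*} [Field K] [IsAlgClosed K]
    [AddCommGroup V] [Module K V] [FiniteDimensional K V] {n : ℕ} [NeZero (n : K)] {ζ : K}
    (hζ : IsPrimitiveRoot ζ n) {f : Module.End K V} (hf : f ^ n = 1) :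
    ∃ p : ℤ[X], ∀ k : ℕ, LinearMap.trace K V (f ^ k) = aeval (ζ ^ k) p := by
  have hn : n ≠ 0 := fun h => NeZero.ne (n : K) (by simp [h])
  have hss : f.IsSemisimple :=
    Module.End.isSemisimple_of_squarefree_aeval_eq_zero
      (X_pow_sub_one_separable_iff.mpr (NeZero.ne (n : K))).squarefree (by simp [hf])
  have hinj : Function.Injective fun i : Fin n => ζ ^ (i : ℕ) := fun i j hij =>
    Fin.ext (hζ.pow_inj i.2 j.2 hij)
  have htop : ⨆ i : Fin n, f.eigenspace (ζ ^ (i : ℕ)) = ⊤ := by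
    rw [eq_top_iff, ← hss.iSup_eigenspace_eq_top]
    refine iSup_le fun μ v hv => ?_
    by_cases hv0 : v = 0
    · simp [hv0]
    have hμ : μ ^ n = 1 := by
      have h := (Module.End.HasEigenvector.pow_apply ⟨hv, hv0⟩ n : (f ^ n) v = μ ^ n • v)
      rw [hf, Module.End.one_apply] at h
      exact smul_left_injective K hv0 (by simpa using h.symm)
    have : NeZero n := ⟨hn⟩
    obtain ⟨i, hi, rfl⟩ := hζ.eq_pow_of_pow_eq_one hμ
    exact Submodule.mem_iSup_of_mem (p := fun i : Fin n => f.eigenspace (ζ ^ (i : ℕ))) ⟨i, hi⟩ hv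
  have hint := DirectSum.isInternal_submodule_of_iSupIndep_of_iSup_eq_top
    (f.eigenspaces_iSupIndep.comp hinj) htop
  refine ⟨∑ i : Fin n, C (Module.finrank K (f.eigenspace (ζ ^ (i : ℕ))) : ℤ) * X ^ (i : ℕ),
    fun k => ?_⟩
  have hpow : ∀ (i : Fin n), ∀ v ∈ f.eigenspace (ζ ^ (i : ℕ)),
      (f ^ k) v = (ζ ^ (i : ℕ)) ^ k • v := by
    intro i v hv
    by_cases hv0 : v = 0
    · simp [hv0]
    exact Module.End.HasEigenvector.pow_apply ⟨hv, hv0⟩ k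
  have hmaps : ∀ i : Fin n, Set.MapsTo (f ^ k) (f.eigenspace (ζ ^ (i : ℕ)))
      (f.eigenspace (ζ ^ (i : ℕ))) := fun i v hv => by
    rw [hpow i v hv]
    exact Submodule.smul_mem _ _ hv
  rw [LinearMap.trace_eq_sum_trace_restrict hint hmaps, map_sum]
  refine Finset.sum_congr rfl fun i _ => ?_
  have : (f ^ k).restrict (hmaps i) = (ζ ^ (i : ℕ)) ^ k • LinearMap.id :=
    LinearMap.ext fun v => Subtype.ext (hpow i v v.2)
  change LinearMap.trace K (f.eigenspace (ζ ^ (i : ℕ))) ((f ^ k).restrict (hmaps i)) = _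
  rw [this, map_smul, LinearMap.trace_id]
  simp [mul_comm, ← pow_mul]

/-- An integer polynomial that takes the same value at all primitive `n`-th roots of unity takes
an integer value there. -/
theorem exists_int_eq_of_forall_primitiveRoots_aeval_eq {K : Type*} [Field K] [CharZero K] {n : ℕ}
    (hn : n ≠ 0) {ζ : K} (hζ : IsPrimitiveRoot ζ n) {p : ℤ[X]} {c : K}
    (hp : ∀ k : ℕ, k.Coprime n → aeval (ζ ^ k) p = c) : ∃ m : ℤ, c = m := by
  have : NeZero n := ⟨hn⟩
  set r := p %ₘ cyclotomic n ℤ with hr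
  have hroot : ∀ μ ∈ primitiveRoots n K, aeval μ r = c := by
    intro μ hμ
    have hμ' := (mem_primitiveRoots (Nat.pos_of_ne_zero hn)).1 hμ
    obtain ⟨k, -, hk, rfl⟩ := hζ.isPrimitiveRoot_iff.1 hμ'
    rw [← hp k hk, hr]
    refine (aeval_modByMonic_eq_self_of_root ?_)
    have := hμ'.isRoot_cyclotomic (Nat.pos_of_ne_zero hn)
    rwa [IsRoot, ← map_cyclotomic_int, eval_map] at this
  have hdeg : (r.map (Int.castRingHom K) - C c).degree < (primitiveRoots n K).card := by
    rw [hζ.card_primitiveRoots]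
    refine (degree_sub_le _ _).trans_lt (max_lt ?_ ?_)
    · rw [← degree_cyclotomic n ℤ]
      exact degree_map_le.trans_lt (degree_modByMonic_lt _ (cyclotomic.monic n ℤ))
    · exact degree_C_le.trans_lt (by exact_mod_cast Nat.totient_pos.2 (Nat.pos_of_ne_zero hn))
  have hz := eq_zero_of_degree_lt_of_eval_finset_eq_zero (primitiveRoots n K) hdeg
    fun μ hμ => by simpa [aeval_def, eval_map] using sub_eq_zero.2 (hroot μ hμ)
  refine ⟨r.coeff 0, ?_⟩
  have := congrArg (coeff · 0) (sub_eq_zero.1 hz)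
  simpa using this.symm

namespace Representation

variable {G V : Type*} [Group G] [Finite G] [AddCommGroup V] [Module ℂ V]
  [FiniteDimensional ℂ V] (ρ : Representation ℂ G V)

theorem exists_int_polynomial_character_pow_eq {ζ : ℂ} (hζ : IsPrimitiveRoot ζ (Nat.card G))
    (g : G) : ∃ p : ℤ[X], ∀ k : ℕ, ρ.character (g ^ k) = aeval (ζ ^ k) p := by
  have : NeZero ((Nat.card G : ℕ) : ℂ) := ⟨Nat.cast_ne_zero.2 Nat.card_pos.ne'⟩
  simpa only [character, map_pow] using
    exists_int_polynomial_trace_pow_eq hζ (f := ρ g) (by rw [← map_pow, pow_card_eq_one', map_one])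

/-- The complex character of a finite group at `g⁻¹` is conjugate to its value at `g`. -/
theorem character_inv_eq_conj (g : G) :
    ρ.character g⁻¹ = starRingEnd ℂ (ρ.character g) := by
  have hζ := Complex.isPrimitiveRoot_exp (Nat.card G) Nat.card_pos.ne'
  obtain ⟨p, hp⟩ := ρ.exists_int_polynomial_character_pow_eq hζ g
  have hinv : g⁻¹ = g ^ (Nat.card G - 1) := by
    rw [inv_eq_iff_mul_eq_one, ← pow_succ', Nat.sub_add_cancel Nat.card_pos, pow_card_eq_one']
  have hconj : Complex.exp (2 * Real.pi * Complex.I / (Nat.card G : ℕ)) ^ (Nat.card G - 1) =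
      starRingEnd ℂ (Complex.exp (2 * Real.pi * Complex.I / (Nat.card G : ℕ))) := by
    rw [← Complex.inv_eq_conj (hζ.norm'_eq_one Nat.card_pos.ne')]
    refine eq_inv_of_mul_eq_one_left ?_
    rw [← pow_succ, Nat.sub_add_cancel Nat.card_pos, hζ.pow_eq_one]
  have h1 := hp 1
  rw [pow_one, pow_one] at h1
  rw [hinv, hp, hconj, h1]
  exact aeval_algHom_apply ((starRingEnd ℂ).toIntAlgHom) _ p

/-- The product of all values of a complex character of a finite group is an integer. -/
theorem exists_int_eq_prod_character [Fintype G] : ∃ m : ℤ, ∏ g : G, ρ.character g = m := by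
  have hζ := Complex.isPrimitiveRoot_exp (Nat.card G) Nat.card_pos.ne'
  choose p hp using ρ.exists_int_polynomial_character_pow_eq hζ
  refine exists_int_eq_of_forall_primitiveRoots_aeval_eq Nat.card_pos.ne' hζ
    (p := ∏ g : G, p g) fun k hk => ?_
  simp only [map_prod, ← hp]
  exact Fintype.prod_equiv (powCoprime hk.symm) _ _ fun g => rfl

/-- First orthogonality relation for a single irreducible complex character. -/
theorem sum_normSq_character [Fintype G] [IsIrreducible ρ] :
    ∑ g : G, ‖ρ.character g‖ ^ 2 = Nat.card G := by
  have hG : ((Nat.card G : ℕ) : ℂ) ≠ 0 := Nat.cast_ne_zero.2 Nat.card_pos.ne'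
  let _ : Invertible ((Nat.card G : ℕ) : ℂ) := invertibleOfNonzero hG
  have h := char_orthonormal ρ ρ
  rw [if_pos ⟨Equiv.refl ρ⟩, inv_mul_eq_one₀ hG] at h
  have h' : ((∑ g : G, ‖ρ.character g‖ ^ 2 : ℝ) : ℂ) = ((Nat.card G : ℕ) : ℝ) := by
    push_cast
    rw [h]
    exact Finset.sum_congr rfl fun g _ => by
      rw [character_inv_eq_conj, Complex.mul_conj']
  exact_mod_cast h'

/-- Burnside's theorem on zeros of characters: a nonlinear irreducible complex character of a
finite group vanishes somewhere. -/
theorem exists_character_eq_zero_of_finrank_ne_one [IsIrreducible ρ]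
    (hV : Module.finrank ℂ V ≠ 1) : ∃ g : G, ρ.character g = 0 := by
  by_contra! hne
  have := Fintype.ofFinite G
  obtain ⟨m, hm⟩ := ρ.exists_int_eq_prod_character
  have hpos : ∀ g : G, 0 < ‖ρ.character g‖ ^ 2 := fun g => pow_pos (norm_pos_iff.2 (hne g)) 2
  have hm0 : m ≠ 0 := by
    rintro rfl
    exact Finset.prod_ne_zero_iff.2 (fun g _ => hne g) (by simpa using hm)
  have hlog : 0 ≤ ∑ g : G, Real.log (‖ρ.character g‖ ^ 2) := by
    rw [← Real.log_prod fun g _ => (hpos g).ne', Finset.prod_pow, ← norm_prod, hm]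
    refine Real.log_nonneg (one_le_pow₀ ?_)
    rw [Complex.norm_intCast]
    exact_mod_cast Int.one_le_abs hm0
  have hlt : ∑ g : G, Real.log (‖ρ.character g‖ ^ 2) < ∑ g : G, (‖ρ.character g‖ ^ 2 - 1) := by
    refine Finset.sum_lt_sum (fun g _ => Real.log_le_sub_one_of_pos (hpos g)) ⟨1, by simp, ?_⟩
    refine Real.log_lt_sub_one_of_pos (hpos 1) ?_
    rw [char_one, Complex.norm_natCast]
    exact_mod_cast fun h => hV (by simpa using h)
  rw [Finset.sum_sub_distrib, ρ.sum_normSq_character] at hlt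
  exact (hlog.trans_lt hlt).ne (by simp)

end Representation

namespace MonoidAlgebra

open scoped MonoidAlgebra commutatorElement

variable {G : Type*} [Group G] [Finite G]

variable (R : Type*) [CommRing R]

/-- The sum, in the group algebra, of the elements of a conjugacy class. -/
noncomputable def classSum (c : ConjClasses G) : R[G] :=
  ∑ x ∈ c.carrier.toFinite.toFinset, single x 1

/-- The sum, in the group algebra, of the elements of the commutator subgroup. -/
noncomputable def commutatorSum (G : Type*) [Group G] [Finite G] : R[G] :=
  ∑ h ∈ (commutator G : Set G).toFinite.toFinset, single h 1

@[simp]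
theorem mapRingHom_classSum {S : Type*} [CommRing S] (f : R →+* S) (c : ConjClasses G) :
    mapRingHom G f (classSum R c) = classSum S c := by
  simp [classSum]

theorem single_mul_classSum (c : ConjClasses G) (g : G) :
    single g 1 * classSum R c = classSum R c * single g 1 := by
  simp only [classSum, Finset.mul_sum, Finset.sum_mul, single_mul_single, mul_one]
  have hmem : ∀ a x : G, x ∈ c.carrier → a * x * a⁻¹ ∈ c.carrier := fun a x hx => by
    rw [ConjClasses.mem_carrier_iff_mk_eq] at hx ⊢
    rw [← hx, ConjClasses.mk_eq_mk_iff_isConj, isConj_comm]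
    exact isConj_iff.2 ⟨a, rfl⟩
  refine Finset.sum_bij' (fun x _ => g * x * g⁻¹) (fun x _ => g⁻¹ * x * g) ?_ ?_ ?_ ?_ ?_
  · simpa using hmem g
  · simpa using hmem g⁻¹
  all_goals intros; simp [mul_assoc]

theorem classSum_mem_center (c : ConjClasses G) : classSum R c ∈ Submonoid.center R[G] := by
  rw [Submonoid.mem_center_iff]
  intro z
  induction z using MonoidAlgebra.induction_on with
  | of g => exact single_mul_classSum R c g
  | add x y hx hy => rw [add_mul, mul_add, hx, hy]
  | smul r x hx => rw [smul_mul_assoc, mul_smul_comm, hx]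

theorem single_mul_commutatorSum {h : G} (hh : h ∈ commutator G) :
    single h 1 * commutatorSum R G = commutatorSum R G := by
  simp only [commutatorSum, Finset.mul_sum, single_mul_single, mul_one]
  refine Finset.sum_bij' (fun x _ => h * x) (fun x _ => h⁻¹ * x) ?_ ?_ ?_ ?_ ?_
  · simpa using fun x hx => mul_mem hh hx
  · simpa using fun x hx => mul_mem (inv_mem hh) hx
  all_goals intros; simp

theorem coeff_commutatorSum_one : (commutatorSum R G).coeff 1 = 1 := by
  classical
  simp [commutatorSum, coeff_sum, Finsupp.single_apply, one_mem]

theorem classSum_mul_single_mul_commutatorSum (x g : G) :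
    classSum R (ConjClasses.mk x) * (single g 1 * commutatorSum R G) =
      Nat.card (ConjClasses.mk x).carrier • (single (x * g) 1 * commutatorSum R G) := by
  rw [classSum, Finset.sum_mul, Nat.card_coe_set_eq,
    Set.ncard_eq_toFinset_card _ (ConjClasses.mk x).carrier.toFinite]
  refine Finset.sum_eq_card_nsmul fun y hy => ?_
  rw [Set.Finite.mem_toFinset, ConjClasses.mem_carrier_iff_mk_eq,
    ConjClasses.mk_eq_mk_iff_isConj, isConj_comm] at hy
  obtain ⟨u, rfl⟩ := isConj_iff.1 hy
  have hmem : g⁻¹ * ⁅x⁻¹, u⁆ * g ∈ commutator G :=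
    (inferInstance : (commutator G).Normal).conj_mem' _
      (Subgroup.commutator_mem_commutator (Subgroup.mem_top _) (Subgroup.mem_top _)) g
  have hyg : u * x * u⁻¹ * g = x * g * (g⁻¹ * ⁅x⁻¹, u⁆ * g) := by
    rw [commutatorElement_def]
    group
  rw [← mul_assoc, single_mul_single, mul_one, hyg]
  conv_lhs => rw [← mul_one (1 : R), ← single_mul_single, mul_assoc,
    single_mul_commutatorSum R hmem]

theorem exists_prod_classSum_mul_commutatorSum (l : List (ConjClasses G)) :
    ∃ g : G, (l.map (classSum R)).prod * commutatorSum R G =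
      (l.map fun c => Nat.card c.carrier).prod • (single g 1 * commutatorSum R G) := by
  induction l with
  | nil => exact ⟨1, by simp [← one_def]⟩
  | cons c l ih =>
    obtain ⟨g, hg⟩ := ih
    obtain ⟨x, rfl⟩ := ConjClasses.exists_rep c
    refine ⟨x * g, ?_⟩
    rw [List.map_cons, List.prod_cons, mul_assoc, hg, mul_smul_comm,
      classSum_mul_single_mul_commutatorSum, smul_smul, List.map_cons, List.prod_cons, mul_comm]

end MonoidAlgebra

theorem RestrictScalars.moduleFinite (R S M : Type*) [CommSemiring R] [Semiring S] [Algebra R S]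
    [AddCommGroup M] [Module S M] [Module.Finite R S] [Module.Finite S M] :
    Module.Finite R (RestrictScalars R S M) :=
  letI : Module S (RestrictScalars R S M) := RestrictScalars.moduleOrig R S M
  haveI : Module.Finite S (RestrictScalars R S M) := ‹Module.Finite S M›
  .trans S _

namespace Representation

open MonoidAlgebra

variable {G V : Type*} [Group G] [Finite G] [AddCommGroup V] [Module ℂ V]
  [FiniteDimensional ℂ V] (ρ : Representation ℂ G V)

/-- A class sum acts as zero on an irreducible representation whose character vanishes on the
class. -/
theorem asAlgebraHom_classSum_eq_zero [IsIrreducible ρ] {g : G} (hg : ρ.character g = 0) :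
    ρ.asAlgebraHom (classSum ℂ (ConjClasses.mk g)) = 0 := by
  set z := IntertwiningMap.centralAlgebraMul ρ (classSum_mem_center ℂ (ConjClasses.mk g)) with hz
  obtain ⟨s, hs⟩ := IsIrreducible.algebraMap_intertwiningMap_bijective_of_isAlgClosed.2 z
  have hsmul : ρ.asAlgebraHom (classSum ℂ (ConjClasses.mk g)) = s • LinearMap.id := by
    change z.toLinearMap = _
    rw [← hs]
    rfl
  have htrace : LinearMap.trace ℂ V (ρ.asAlgebraHom (classSum ℂ (ConjClasses.mk g))) = 0 := by
    rw [classSum, map_sum, map_sum]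
    refine Finset.sum_eq_zero fun y hy => ?_
    rw [Set.Finite.mem_toFinset, ConjClasses.mem_carrier_iff_mk_eq,
      ConjClasses.mk_eq_mk_iff_isConj, isConj_comm] at hy
    obtain ⟨u, rfl⟩ := isConj_iff.1 hy
    rw [asAlgebraHom_single_one]
    exact (ρ.char_conj g u).trans hg
  have : Nontrivial V := IsSimpleModule.nontrivial (MonoidAlgebra ℂ G) ρ.asModule
  rw [hsmul, map_smul, LinearMap.trace_id, smul_eq_mul, mul_eq_zero,
    Nat.cast_eq_zero] at htrace
  rw [hsmul, htrace.resolve_right Module.finrank_pos.ne', zero_smul]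

omit [Finite G] [FiniteDimensional ℂ V] in
theorem apply_eq_one_of_finrank_eq_one (hV : Module.finrank ℂ V = 1) {h : G}
    (hh : h ∈ commutator G) : ρ h = 1 := by
  have hcomm : ∀ a b : Module.End ℂ V, a * b = b * a := by
    intro a b
    obtain ⟨r, rfl⟩ := (LinearEquiv.smul_id_of_finrank_eq_one hV).surjective a
    obtain ⟨s, rfl⟩ := (LinearEquiv.smul_id_of_finrank_eq_one hV).surjective b
    ext v
    simp [smul_smul, mul_comm]
  have hle : commutator G ≤ (MonoidHom.toHomUnits ρ).ker := by
    rw [commutator_def, Subgroup.commutator_le]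
    intro a _ b _
    rw [MonoidHom.mem_ker, map_commutatorElement, commutatorElement_eq_one_iff_mul_comm]
    exact Units.ext (hcomm _ _)
  simpa using congrArg Units.val (MonoidHom.mem_ker.1 (hle hh))

/-- On an irreducible representation, the product of all class sums is invariant under the
commutator subgroup. -/
theorem asAlgebraHom_prod_classSum_mul_apply [IsIrreducible ρ] {l : List (ConjClasses G)}
    (hl : ∀ c, c ∈ l) {h : G} (hh : h ∈ commutator G) (v : V) :
    ρ.asAlgebraHom ((l.map (classSum ℂ)).prod * (single h 1 - 1)) v = 0 := by
  refine LinearMap.congr_fun (g := 0) ?_ v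
  rw [map_mul]
  by_cases hV : Module.finrank ℂ V = 1
  · rw [map_sub, asAlgebraHom_single_one, ρ.apply_eq_one_of_finrank_eq_one hV hh, map_one,
      sub_self, mul_zero]
  · obtain ⟨g, hg⟩ := ρ.exists_character_eq_zero_of_finrank_ne_one hV
    rw [map_list_prod, List.prod_eq_zero, zero_mul]
    rw [List.map_map]
    exact List.mem_map.2 ⟨_, hl (ConjClasses.mk g), ρ.asAlgebraHom_classSum_eq_zero hg⟩

end Representation

namespace MonoidAlgebra

open scoped MonoidAlgebra

variable {G : Type*} [Group G] [Finite G]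

/-- On a simple module, the product of all class sums is invariant under the commutator
subgroup. -/
theorem prod_classSum_mul_smul_eq_zero {M : Type*} [AddCommGroup M] [Module ℂ[G] M]
    [hM : IsSimpleModule ℂ[G] M] {l : List (ConjClasses G)} (hl : ∀ c, c ∈ l) {h : G}
    (hh : h ∈ commutator G) (m : M) :
    ((l.map (classSum ℂ)).prod * (single h 1 - 1) : ℂ[G]) • m = 0 := by
  have := (Representation.isSimpleModule_iff_irreducible_ofModule (k := ℂ) (G := G) M).1 hM
  have := RestrictScalars.moduleFinite ℂ ℂ[G] M
  have h0 := @Representation.asAlgebraHom_prod_classSum_mul_apply G (RestrictScalars ℂ ℂ[G] M) _ _ _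
    (RestrictScalars.module ℂ ℂ[G] M) ‹_› (Representation.ofModule M) ‹_› l hl h hh
    ((RestrictScalars.addEquiv ℂ ℂ[G] M).symm m)
  exact (congrArg (RestrictScalars.addEquiv ℂ ℂ[G] M)
    (Representation.ofModule_asAlgebraHom_apply_apply M _ _)).symm.trans
    (congrArg (RestrictScalars.addEquiv ℂ ℂ[G] M) h0)

/-- The product of all class sums is invariant under the commutator subgroup. -/
theorem prod_classSum_mul_single {l : List (ConjClasses G)} (hl : ∀ c, c ∈ l) {h : G}
    (hh : h ∈ commutator G) :
    (l.map (classSum ℂ)).prod * single h 1 = (l.map (classSum ℂ)).prod := by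
  have : NeZero ((Nat.card G : ℕ) : ℂ) := ⟨Nat.cast_ne_zero.2 Nat.card_pos.ne'⟩
  rw [← sub_eq_zero]
  nth_rewrite 2 [← mul_one (List.prod _)]
  rw [← mul_sub, ← Submodule.mem_bot ℂ[G], ← IsSemisimpleRing.jacobson_eq_bot ℂ[G],
    Ring.jacobson_eq_sInf_isMaximal, Ideal.mem_sInf]
  intro I hI
  have : IsSimpleModule ℂ[G] (ℂ[G] ⧸ I) := isSimpleModule_iff_isCoatom.2 (Ideal.isMaximal_def.1 hI)
  have h0 := prod_classSum_mul_smul_eq_zero hl hh (Submodule.Quotient.mk 1 : ℂ[G] ⧸ I)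
  rwa [← Submodule.Quotient.mk_smul, Submodule.Quotient.mk_eq_zero, smul_eq_mul, mul_one] at h0

end MonoidAlgebra

/-- Let `G` be a finite group whose center has odd order and `P` the product of the
sizes of all of its conjugacy classes. Then `|G'|` divides `P`. -/
theorem card_commutator_dvd_prod_card_conjClasses_of_odd_center
    {G : Type*} [Group G] [Finite G] (hodd : Odd (Nat.card (Subgroup.center G))) :
    Nat.card (commutator G) ∣ ∏ᶠ c : ConjClasses G, Nat.card c.carrier := by
  classical
  have := Fintype.ofFinite (ConjClasses G)
  rw [finprod_eq_prod_of_fintype, ← Finset.prod_map_toList]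
  set l : List (ConjClasses G) := Finset.univ.toList
  have hl : ∀ c, c ∈ l := by simp [l]
  obtain ⟨g, hg⟩ := MonoidAlgebra.exists_prod_classSum_mul_commutatorSum ℂ l
  have hcard : (l.map (MonoidAlgebra.classSum ℂ)).prod * MonoidAlgebra.commutatorSum ℂ G =
      Nat.card (commutator G) • (l.map (MonoidAlgebra.classSum ℂ)).prod := by
    rw [MonoidAlgebra.commutatorSum, Finset.mul_sum]
    refine (Finset.sum_eq_card_nsmul fun h hh =>
      MonoidAlgebra.prod_classSum_mul_single hl (by simpa using hh)).trans ?_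
    rw [← Set.ncard_eq_toFinset_card, ← Nat.card_coe_set_eq]
    rfl
  have hmap : (l.map (MonoidAlgebra.classSum ℂ)).prod =
      MonoidAlgebra.mapRingHom G (Int.castRingHom ℂ) (l.map (MonoidAlgebra.classSum ℤ)).prod := by
    rw [map_list_prod, List.map_map]
    congr 2
    ext1 c
    simp
  have hcoeff := congrArg (fun x : MonoidAlgebra ℂ G => x.coeff g) (hcard.symm.trans hg)
  rw [hmap] at hcoeff
  simp only [MonoidAlgebra.coeff_smul, Finsupp.smul_apply, MonoidAlgebra.coeff_mapRingHom,
    MonoidAlgebra.coeff_single_mul_apply, inv_mul_cancel,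
    MonoidAlgebra.coeff_commutatorSum_one, mul_one] at hcoeff
  simp only [nsmul_eq_mul, eq_intCast, mul_one] at hcoeff
  refine Int.natCast_dvd_natCast.1 ⟨(l.map (MonoidAlgebra.classSum ℤ)).prod.coeff g, ?_⟩
  refine Int.cast_injective (α := ℂ) ?_
  rw [Int.cast_mul, Int.cast_natCast, Int.cast_natCast]
  exact hcoeff.symm
end

section
/- Let G be a finite group with exactly r conjugacy classes K_1, …, K_r, and let P = ∏_{j=1}^{r} |K_j| be the product of all conjugacy class sizes. Then |G'| divides P^{2r+1}. -/
/-- A `p`-group acting on a nonempty finite set has an orbit whose size divides the size of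
the set. -/
theorem IsPGroup.exists_index_stabilizer_dvd_card {p : ℕ} [Fact p.Prime] {S X : Type*} [Group S]
    [Finite S] [MulAction S X] [Finite X] [Nonempty X] (hS : IsPGroup p S) :
    ∃ x : X, (MulAction.stabilizer S x).index ∣ Nat.card X := by
  have hp : p.Prime := Fact.out
  by_contra! h
  have hX : Nat.card X ≠ 0 := Nat.card_pos.ne'
  refine Nat.pow_succ_factorization_not_dvd hX hp ?_
  generalize hv : (Nat.card X).factorization p = v
  cases nonempty_fintype (MulAction.orbitRel.Quotient S X)
  rw [Nat.card_congr (MulAction.selfEquivSigmaOrbitsQuotientStabilizer S X), Nat.card_sigma]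
  refine Finset.dvd_sum fun ω _ => ?_
  obtain ⟨k, hk⟩ := hS.index (MulAction.stabilizer S ω.out)
  have hω := h ω.out
  rw [hk, hp.pow_dvd_iff_le_factorization hX, not_le, hv] at hω
  change _ ∣ (MulAction.stabilizer S ω.out).index
  rw [hk]
  exact pow_dvd_pow p hω

theorem Subgroup.index_centralizer_singleton {G : Type*} [Group G] (g : G) :
    (Subgroup.centralizer {g}).index = Nat.card (ConjClasses.mk g).carrier := by
  rw [← ConjAct.orbit_eq_carrier_conjClasses, Nat.card_coe_set_eq,
    ← MulAction.index_stabilizer, ConjAct.stabilizer_eq_centralizer]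
  rfl

/-- Every conjugacy class `c` of a finite group contains an element whose centralizer meets a
given `p`-subgroup `S` in a subgroup of index dividing the size of `c`. -/
theorem IsPGroup.exists_relIndex_centralizer_dvd {p : ℕ} [Fact p.Prime] {G : Type*} [Group G]
    [Finite G] {S : Subgroup G} (hS : IsPGroup p S) (c : ConjClasses G) :
    ∃ x : G, ConjClasses.mk x = c ∧
      (Subgroup.centralizer {x}).relIndex S ∣ Nat.card c.carrier := by
  induction c using Quotient.inductionOn with | _ g
  change ∃ x : G, ConjClasses.mk x = ConjClasses.mk g ∧ _ ∣ Nat.card (ConjClasses.mk g).carrier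
  obtain ⟨q, hq⟩ :=
    hS.exists_index_stabilizer_dvd_card (X := G ⧸ Subgroup.centralizer {g})
  induction q using QuotientGroup.induction_on with | _ y
  refine ⟨y * g * y⁻¹, ?_, ?_⟩
  · rw [ConjClasses.mk_eq_mk_iff_isConj, isConj_comm, isConj_iff]
    exact ⟨y, rfl⟩
  · rw [← Subgroup.index_centralizer_singleton]
    change _ ∣ (Subgroup.centralizer {g}).index at hq
    convert hq using 1
    unfold Subgroup.relIndex
    congr 1
    ext s
    rw [Subgroup.mem_subgroupOf, Subgroup.mem_centralizer_singleton_iff,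
      MulAction.mem_stabilizer_iff]
    change _ ↔ ((s * y : G) : G ⧸ Subgroup.centralizer {g}) = y
    rw [eq_comm (b := (y : G ⧸ Subgroup.centralizer {g})), QuotientGroup.eq,
      Subgroup.mem_centralizer_singleton_iff]
    constructor <;> intro h
    · have := congrArg (fun z => y⁻¹ * z * y) h
      simpa [mul_assoc] using this
    · have := congrArg (fun z => y * z * y⁻¹) h
      simpa [mul_assoc] using this

/-- **Jordan's theorem**: a subgroup of a finite group meeting every conjugacy class is the whole
group. -/
theorem Subgroup.eq_top_of_forall_exists_isConj_mem {G : Type*} [Group G] [Finite G]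
    {H : Subgroup G} (hH : ∀ g : G, ∃ h ∈ H, IsConj h g) : H = ⊤ := by
  classical
  cases nonempty_fintype G
  have burnside := MulAction.sum_card_fixedBy_eq_card_orbits_mul_card_group G (G ⧸ H)
  have horb : Fintype.card (Quotient (MulAction.orbitRel G (G ⧸ H))) = 1 := by
    rw [Fintype.card_eq_one_iff_nonempty_unique]
    have := (MulAction.pretransitive_iff_subsingleton_quotient G (G ⧸ H)).1 inferInstance
    exact ⟨⟨⟨Quotient.mk'' ((1 : G) : G ⧸ H)⟩, fun _ => Subsingleton.elim _ _⟩⟩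
  rw [horb, one_mul] at burnside
  have hpos : ∀ g : G, 1 ≤ Fintype.card (MulAction.fixedBy (G ⧸ H) g) := by
    intro g
    obtain ⟨h, hh, hc⟩ := hH g
    obtain ⟨y, rfl⟩ := isConj_iff.1 hc
    refine Fintype.card_pos_iff.2 ⟨⟨(y : G ⧸ H), ?_⟩⟩
    rw [MulAction.mem_fixedBy, MulAction.Quotient.smul_coe, eq_comm, QuotientGroup.eq]
    simpa [mul_assoc] using hh
  have hsum : ∑ _g : G, 1 = ∑ g : G, Fintype.card (MulAction.fixedBy (G ⧸ H) g) := by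
    rw [burnside]; simp
  have h1 := (Finset.sum_eq_sum_iff_of_le fun g _ => hpos g).1 hsum 1 (Finset.mem_univ _)
  rw [← Subgroup.index_eq_one, Subgroup.index, h1, Nat.card_eq_fintype_card]
  simp

theorem Subgroup.iInf_centralizer_eq_center {G : Type*} [Group G] [Finite G]
    {f : ConjClasses G → G} (hf : ∀ c, ConjClasses.mk (f c) = c) :
    ⨅ c, Subgroup.centralizer {f c} = Subgroup.center G := by
  refine le_antisymm (fun z hz => ?_) (le_iInf fun c => Subgroup.center_le_centralizer _)
  have htop : Subgroup.centralizer {z} = ⊤ := by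
    refine Subgroup.eq_top_of_forall_exists_isConj_mem fun g => ⟨f (ConjClasses.mk g), ?_, ?_⟩
    · have := Subgroup.mem_iInf.1 hz (ConjClasses.mk g)
      rw [Subgroup.mem_centralizer_singleton_iff] at this ⊢
      exact this.symm
    · exact ConjClasses.mk_eq_mk_iff_isConj.1 (hf _)
  rw [Subgroup.mem_center_iff]
  intro g
  have : g ∈ Subgroup.centralizer {z} := htop ▸ Subgroup.mem_top g
  exact Subgroup.mem_centralizer_singleton_iff.1 this

theorem Subgroup.card_inf_mul_relIndex {G : Type*} [Group G] (H K : Subgroup G) :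
    Nat.card (H ⊓ K : Subgroup G) * H.relIndex K = Nat.card K := by
  rw [← Subgroup.inf_relIndex_right, ← Subgroup.relIndex_bot_left, ← Subgroup.relIndex_bot_left]
  exact Subgroup.relIndex_mul_relIndex _ _ _ bot_le inf_le_right

theorem Subgroup.ordProj_index_dvd_relIndex_sylow {G : Type*} [Group G] [Finite G] {p : ℕ}
    [Fact p.Prime] (S : Sylow p G) (H : Subgroup G) :
    p ^ H.index.factorization p ∣ H.relIndex S := by
  have hp : p.Prime := Fact.out
  have h1 : Nat.card H * H.index = Nat.card G := H.card_mul_index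
  have h2 : Nat.card (H ⊓ S : Subgroup G) * H.relIndex S = Nat.card S :=
    Subgroup.card_inf_mul_relIndex _ _
  have h3 : Nat.card (H ⊓ S : Subgroup G) ∣ Nat.card H := Subgroup.card_dvd_of_le inf_le_left
  have hi : H.index ≠ 0 := Subgroup.FiniteIndex.index_ne_zero
  have hr : H.relIndex S ≠ 0 := Subgroup.FiniteIndex.index_ne_zero
  have hH : Nat.card H ≠ 0 := Nat.card_pos.ne'
  have hI : Nat.card (H ⊓ S : Subgroup G) ≠ 0 := Nat.card_pos.ne'
  rw [hp.pow_dvd_iff_le_factorization hr]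
  have e1 := congrArg (fun n => n.factorization p) h1
  have e2 := congrArg (fun n => n.factorization p) h2
  have e3 := (Nat.factorization_le_iff_dvd hI hH).2 h3 p
  simp only [S.card_eq_multiplicity, Nat.factorization_mul hH hi, Nat.factorization_mul hI hr,
    hp.factorization_pow, Finsupp.add_apply, Finsupp.single_eq_same] at e1 e2
  omega

/-- The index of the center of a finite group divides the product of the sizes of the conjugacy
classes. -/
theorem Subgroup.index_center_dvd_prod_card_conjClasses {G : Type*} [Group G] [Finite G]
    [Fintype (ConjClasses G)] :
    (Subgroup.center G).index ∣ ∏ c : ConjClasses G, Nat.card c.carrier := by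
  have hi : (Subgroup.center G).index ≠ 0 := Subgroup.FiniteIndex.index_ne_zero
  refine (Nat.dvd_iff_prime_pow_dvd_dvd _ _).2 fun p k hp hk => ?_
  have : Fact p.Prime := ⟨hp⟩
  let S : Sylow p G := default
  choose f hf hdvd using S.isPGroup'.exists_relIndex_centralizer_dvd
  rw [hp.pow_dvd_iff_le_factorization hi] at hk
  refine (pow_dvd_pow p hk).trans <| (Subgroup.ordProj_index_dvd_relIndex_sylow S _).trans <|
    dvd_trans ?_ (Finset.prod_dvd_prod_of_dvd _ _ fun c _ => hdvd c)
  have hle := Subgroup.relIndex_iInf_le (L := (S : Subgroup G))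
    fun c => Subgroup.centralizer {f c}
  rw [Subgroup.iInf_centralizer_eq_center hf] at hle
  obtain ⟨a, ha⟩ := S.isPGroup'.index ((Subgroup.center G).subgroupOf S)
  choose b hb using fun c => S.isPGroup'.index ((Subgroup.centralizer {f c}).subgroupOf S)
  simp only [Subgroup.relIndex, ha, hb, Finset.prod_pow_eq_pow_sum] at hle ⊢
  exact pow_dvd_pow p ((Nat.pow_le_pow_iff_right hp.one_lt).1 hle)

theorem Subgroup.card_center_le_card_conjClasses (G : Type*) [Group G] [Finite G] :
    Nat.card (Subgroup.center G) ≤ Nat.card (ConjClasses G) := by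
  refine Nat.card_le_card_of_injective (fun z => ConjClasses.mk (z : G)) fun x y hxy => ?_
  exact Subtype.ext ((ConjClasses.mk_bijOn G).injOn x.2 y.2 hxy)

theorem Nat.dvd_pow_of_forall_prime_dvd {a n r : ℕ} (ha : a ≠ 0) (har : a ≤ r)
    (h : ∀ p : ℕ, p.Prime → p ∣ a → p ∣ n) : a ∣ n ^ r := by
  refine (Nat.dvd_iff_prime_pow_dvd_dvd _ _).2 fun p k hp hk => ?_
  rcases eq_or_ne k 0 with rfl | hk0
  · simp
  have hkr : k ≤ r :=
    ((Nat.lt_pow_self hp.one_lt).le.trans (Nat.le_of_dvd (Nat.pos_of_ne_zero ha) hk)).trans har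
  exact (pow_dvd_pow_of_dvd (h p hp ((dvd_pow_self p hk0).trans hk)) k).trans (pow_dvd_pow n hkr)

theorem card_commutator_dvd_index_center_pow_card_conjClasses (G : Type*) [Group G] [Finite G] :
    Nat.card (commutator G) ∣ (Subgroup.center G).index ^ (Nat.card (ConjClasses G) + 1) := by
  have hcard : Nat.card (Subgroup.center G ⊓ commutator G : Subgroup G) *
      (Subgroup.center G).relIndex (commutator G) = Nat.card (commutator G) :=
    Subgroup.card_inf_mul_relIndex _ _
  rw [← hcard, pow_succ]
  refine mul_dvd_mul (Nat.dvd_pow_of_forall_prime_dvd Nat.card_pos.ne' ?_ fun p hp hdvd => ?_)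
    (Subgroup.relIndex_dvd_index_of_normal _ _)
  · exact (Subgroup.card_le_of_le inf_le_left).trans (Subgroup.card_center_le_card_conjClasses G)
  · exact hp.dvd_of_dvd_pow <| hdvd.trans <| (Dvd.intro _ hcard).trans
      (Subgroup.card_commutator_dvd_index_center_pow G)

/-- Let `G` be a finite group with exactly `r` conjugacy classes and `P` the product of
the sizes of all of its conjugacy classes. Then `|G'|` divides `P ^ (2 * r + 1)`. -/
theorem card_commutator_dvd_prod_card_conjClasses_pow
    {G : Type*} [Group G] [Finite G] (r : ℕ) (hr : Nat.card (ConjClasses G) = r) :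
    Nat.card (commutator G) ∣ (∏ᶠ c : ConjClasses G, Nat.card c.carrier) ^ (2 * r + 1) := by
  cases nonempty_fintype (ConjClasses G)
  rw [finprod_eq_prod_of_fintype]
  subst hr
  exact (card_commutator_dvd_index_center_pow_card_conjClasses G).trans <|
    (pow_dvd_pow_of_dvd Subgroup.index_center_dvd_prod_card_conjClasses _).trans
      (pow_dvd_pow _ (by omega))
end
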